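/- If z ∈ 𝕊 is a zero of P ∈ 𝕊[x], then the characteristic polynomial Ψ_z(x) = x² − 2 re(z) x + det(z) divides the companion polynomial C_P = conj(P) P in 𝕊[x]: there exists Q ∈ 𝕊[x] with C_P = Q Ψ_z (equivalently C_P = Ψ_z Q, since Ψ_z has real coefficients). -/

import Mathlib

open Quaternion Polynomial

noncomputable section

/-- The real algebra of coquaternions (split quaternions):
basis `1, i, j, k` with `i² = -1`, `j² = k² = 1`, `ij = -ji = k`. -/
abbrev CoQ : Type := ℍ[ℝ, -1, 1]

/-- The determinant of a coquaternion: `det q = q₀² + q₁² - q₂² - q₃²` (equals `q * star q`). -/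
def coDet (q : CoQ) : ℝ := q.re ^ 2 + q.imI ^ 2 - q.imJ ^ 2 - q.imK ^ 2

/-- The conjugate polynomial: coefficients are conjugated (`star`) coefficientwise.
(Note: `Polynomial.eval` evaluates with coefficients on the left of powers of the
variable, exactly as unilateral coquaternionic polynomials are evaluated.) -/
def pconj (P : Polynomial CoQ) : Polynomial CoQ := ⟨⟨P.toFinsupp.coeff.mapRange star (star_zero _)⟩⟩

/-- The characteristic polynomial of the quasi-similarity class of `q`:
`Ψ_q(x) = x² - 2 re(q) x + det(q)`, a polynomial with real coefficients. -/
def charPoly (q : CoQ) : Polynomial CoQ :=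
  X ^ 2 - C ((2 * q.re : ℝ) : CoQ) * X + C ((coDet q : ℝ) : CoQ)

theorem coeff_pconj (P : Polynomial CoQ) (n : ℕ) : (pconj P).coeff n = star (P.coeff n) := rfl

theorem pconj_mul (A B : Polynomial CoQ) : pconj (A * B) = pconj B * pconj A := by
  ext1 n
  simp only [coeff_pconj, coeff_mul, star_sum, star_mul]
  exact Finset.sum_equiv (Equiv.prodComm ℕ ℕ) (by simp [add_comm]) (by simp)

theorem pconj_pconj (P : Polynomial CoQ) : pconj (pconj P) = P := by
  ext1 n
  simp only [coeff_pconj, star_star]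

theorem pconj_X_sub_C (z : CoQ) : pconj (X - C z) = X - C (star z) := by
  ext1 n
  simp only [coeff_pconj, coeff_sub, coeff_X, coeff_C, star_sub]
  split_ifs <;> simp

/-- A polynomial fixed by conjugation has real coefficients, hence is central. -/
theorem commute_of_pconj_eq {S : Polynomial CoQ} (hS : pconj S = S) (T : Polynomial CoQ) :
    S * T = T * S := by
  ext1 n
  rw [coeff_mul, coeff_mul]
  refine Finset.sum_equiv (Equiv.prodComm ℕ ℕ) (by simp [add_comm]) fun p _ => ?_
  have h : star (S.coeff p.1) = S.coeff p.1 := by rw [← coeff_pconj, hS]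
  change Commute (S.coeff p.1) (T.coeff p.2)
  rw [QuaternionAlgebra.star_eq_self.mp h]
  exact QuaternionAlgebra.coe_commute _ _

/-- A right zero of a polynomial over a ring gives a linear right factor. -/
theorem exists_eq_mul_X_sub_C_of_eval_eq_zero {R : Type*} [Ring R] {P : Polynomial R} {z : R}
    (hz : P.eval z = 0) : ∃ Q : Polynomial R, P = Q * (X - C z) := by
  refine ⟨P.sum fun n a => C a * ∑ i ∈ Finset.range n, X ^ i * C z ^ (n - 1 - i), ?_⟩
  have h : C (P.eval z) = P.sum fun n a => C a * C z ^ n := by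
    simp [eval_eq_sum, Polynomial.sum]
  calc P = P - C (P.eval z) := by rw [hz, C_0, sub_zero]
    _ = _ := by
      rw [h]
      conv_lhs => enter [1]; rw [P.as_sum_support_C_mul_X_pow]
      simp only [Polynomial.sum, Finset.sum_mul, ← Finset.sum_sub_distrib]
      refine Finset.sum_congr rfl fun n _ => ?_
      rw [mul_assoc, (commute_X (C z)).geom_sum₂_mul, mul_sub]

theorem X_sub_C_star_mul_X_sub_C (z : CoQ) : (X - C (star z)) * (X - C z) = charPoly z := by
  have hadd : ((2 * z.re : ℝ) : CoQ) = z + star z := by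
    ext <;> simp [two_mul]
  have hmul : ((coDet z : ℝ) : CoQ) = star z * z := by
    ext <;> simp only [QuaternionAlgebra.re_coe, QuaternionAlgebra.imI_coe,
      QuaternionAlgebra.imJ_coe, QuaternionAlgebra.imK_coe, coDet] <;> simp <;> ring
  rw [charPoly, hadd, hmul, C_add, C_mul, sub_mul, mul_sub, mul_sub, X_mul_C, add_mul, pow_two]
  abel

/-- If `z` is a zero of `P`, then the characteristic polynomial of the class of `z`
divides the companion polynomial `pconj P * P`. -/
theorem stmt_11 (P : Polynomial CoQ) (z : CoQ) (hz : P.eval z = 0) :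
    ∃ Q : Polynomial CoQ, pconj P * P = Q * charPoly z := by
  obtain ⟨R, rfl⟩ := exists_eq_mul_X_sub_C_of_eval_eq_zero hz
  refine ⟨pconj R * R, ?_⟩
  have hR : pconj (pconj R * R) = pconj R * R := by rw [pconj_mul, pconj_pconj]
  rw [pconj_mul, pconj_X_sub_C, ← X_sub_C_star_mul_X_sub_C, ← mul_assoc (pconj R * R),
    commute_of_pconj_eq hR]
  simp only [mul_assoc]
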